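/- Let S^2 be the standard round 2-sphere of constant curvature 1. If μ is a finite signed measure on the unit tangent bundle S(S^2) that is invariant under the geodesic flow G_t for every t ∈ ℝ and invariant under the flip map σ, and if the pushforward of μ under the canonical projection π : S(S^2) → S^2 is the zero measure, then μ = 0. That is, even G_t-invariant finite signed measures on S(S^2) are determined by their projection to S^2. -/

import Mathlib

open MeasureTheory Real RealInnerProductSpace

noncomputable section

/-- `ℝ^{n+1}`, the ambient Euclidean space of the `n`-sphere. -/
abbrev Euc (n : ℕ) : Type := EuclideanSpace ℝ (Fin (n + 1))

/-- The unit tangent bundle `S(Sⁿ)` of the standard round sphere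
`Sⁿ ⊆ ℝ^{n+1}` of constant curvature 1, realized as the set of pairs `(x, v)`
with `‖x‖ = 1`, `‖v‖ = 1` and `⟨x, v⟩ = 0`. -/
def UnitTangentSphere (n : ℕ) : Set (Euc n × Euc n) :=
  {p | ‖p.1‖ = 1 ∧ ‖p.2‖ = 1 ∧ ⟪p.1, p.2⟫ = 0}

lemma norm_eq_one_of_sq (a : ℝ) (h0 : 0 ≤ a) (h : a ^ 2 = 1) : a = 1 := by
  have h1 : (a - 1) * (a + 1) = 0 := by nlinarith
  rcases mul_eq_zero.1 h1 with h2 | h2 <;> linarith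

lemma geodesicFlow_mem {n : ℕ} (t : ℝ) {p : Euc n × Euc n}
    (hp : p ∈ UnitTangentSphere n) :
    (cos t • p.1 + sin t • p.2, -sin t • p.1 + cos t • p.2) ∈ UnitTangentSphere n := by
  obtain ⟨hx, hv, hxv⟩ := hp
  have hvx : ⟪p.2, p.1⟫ = 0 := by rw [real_inner_comm]; exact hxv
  have hxx : ⟪p.1, p.1⟫ = 1 := by
    rw [real_inner_self_eq_norm_mul_norm, hx]; ring
  have hvv : ⟪p.2, p.2⟫ = 1 := by
    rw [real_inner_self_eq_norm_mul_norm, hv]; ring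
  have hpyth := sin_sq_add_cos_sq t
  refine ⟨?_, ?_, ?_⟩
  · apply norm_eq_one_of_sq _ (norm_nonneg _)
    rw [norm_add_sq_real, inner_smul_left, inner_smul_right, norm_smul, norm_smul, hx, hv, hxv]
    simp [sq_abs]
  · apply norm_eq_one_of_sq _ (norm_nonneg _)
    rw [norm_add_sq_real, inner_smul_left, inner_smul_right, norm_smul, norm_smul, hx, hv, hxv]
    simp [sq_abs]
  · simp only [inner_add_left, inner_add_right, inner_smul_left, inner_smul_right,
      hxx, hvv, hxv, hvx, RCLike.star_def, conj_trivial]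
    ring

/-- The geodesic flow `G_t` on the unit tangent bundle of the round sphere:
`G_t (x, v) = (cos t • x + sin t • v, -sin t • x + cos t • v)`. -/
def geodesicFlow (n : ℕ) (t : ℝ) (p : UnitTangentSphere n) : UnitTangentSphere n :=
  ⟨(cos t • (p : Euc n × Euc n).1 + sin t • (p : Euc n × Euc n).2,
    -sin t • (p : Euc n × Euc n).1 + cos t • (p : Euc n × Euc n).2),
   geodesicFlow_mem t p.2⟩

lemma flip_mem {n : ℕ} {p : Euc n × Euc n} (hp : p ∈ UnitTangentSphere n) :
    ((p.1, -p.2) : Euc n × Euc n) ∈ UnitTangentSphere n := by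
  obtain ⟨hx, hv, hxv⟩ := hp
  exact ⟨hx, by simpa using hv, by simpa using hxv⟩

/-- The flip map `σ (x, v) = (x, -v)` on the unit tangent bundle. -/
def flipMap (n : ℕ) (p : UnitTangentSphere n) : UnitTangentSphere n :=
  ⟨((p : Euc n × Euc n).1, -(p : Euc n × Euc n).2), flip_mem p.2⟩

/-- The canonical projection `π : S(Sⁿ) → Sⁿ`, `π (x, v) = x`. -/
def sphereProj (n : ℕ) (p : UnitTangentSphere n) : Metric.sphere (0 : Euc n) 1 :=
  ⟨(p : Euc n × Euc n).1, by
    rw [mem_sphere_zero_iff_norm]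
    exact p.2.1⟩

namespace FlamAux

section General

variable {T : Type*} [TopologicalSpace T] [CompactSpace T] [MeasurableSpace T] [BorelSpace T]

/-- Integral against the difference of two measures. -/
def J (P Q : Measure T) (f : T → ℝ) : ℝ := ∫ p, f p ∂P - ∫ p, f p ∂Q

lemma integrable_cont {F : Type*} [NormedAddCommGroup F] [SecondCountableTopology F]
    (P : Measure T) [IsFiniteMeasure P] {f : T → F} (hf : Continuous f) : Integrable f P := by
  obtain ⟨C, hC⟩ := isCompact_univ.exists_bound_of_continuousOn (f := f) hf.continuousOn
  borelize F
  exact Integrable.of_bound hf.measurable.aestronglyMeasurable C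
    (Filter.Eventually.of_forall fun x => hC x (Set.mem_univ x))

lemma J_sum (P Q : Measure T) [IsFiniteMeasure P] [IsFiniteMeasure Q] {ι : Type*} (s : Finset ι)
    (c : ι → ℝ) (f : ι → T → ℝ) (hf : ∀ i, Continuous (f i)) :
    J P Q (fun p => ∑ i ∈ s, c i * f i p) = ∑ i ∈ s, c i * J P Q (f i) := by
  unfold J
  rw [integral_finsetSum _ (fun i _ => integrable_cont P (f := fun p => c i * f i p) (continuous_const.mul (hf i))),
    integral_finsetSum _ (fun i _ => integrable_cont Q (f := fun p => c i * f i p) (continuous_const.mul (hf i))),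
    ← Finset.sum_sub_distrib]
  refine Finset.sum_congr rfl fun i _ => ?_
  rw [integral_const_mul, integral_const_mul]; ring

lemma hasSum_cexp (P : Measure T) [IsFiniteMeasure P] {f : T → ℝ} (hf : Continuous f) :
    HasSum (fun n : ℕ => ((∫ p, f p ^ n ∂P : ℝ) : ℂ) * (Complex.I ^ n / (n.factorial : ℂ)))
      (∫ p, Complex.exp (f p * Complex.I) ∂P) := by
  obtain ⟨C, hC⟩ := isCompact_univ.exists_bound_of_continuousOn (f := f) hf.continuousOn
  have key := hasSum_integral_of_dominated_convergence (μ := P)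
    (F := fun (n : ℕ) p => ((f p : ℂ) * Complex.I) ^ n / (n.factorial : ℂ))
    (f := fun p => Complex.exp (f p * Complex.I))
    (fun n _ => |C| ^ n / n.factorial) ?_ ?_ ?_ ?_ ?_
  · have e : (fun n : ℕ => ((∫ p, f p ^ n ∂P : ℝ) : ℂ) * (Complex.I ^ n / (n.factorial : ℂ)))
        = fun n : ℕ => ∫ p, ((f p : ℂ) * Complex.I) ^ n / (n.factorial : ℂ) ∂P := by
      ext n
      rw [← integral_complex_ofReal, ← integral_mul_const]
      refine integral_congr_ae (Filter.Eventually.of_forall fun p => ?_)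
      simp only [mul_pow]
      push_cast
      ring
    rw [e]
    exact key
  · intro n
    exact (integrable_cont P (by fun_prop)).aestronglyMeasurable
  · intro n
    refine Filter.Eventually.of_forall fun p => ?_
    have := hC p (Set.mem_univ p)
    simp only [norm_div, norm_pow, norm_mul, Complex.norm_real, Complex.norm_I, mul_one,
      Complex.norm_natCast]
    gcongr
    exact this.trans (le_abs_self C)
  · exact Filter.Eventually.of_forall fun p => Real.summable_pow_div_factorial _
  · exact integrable_const _
  · refine Filter.Eventually.of_forall fun p => ?_
    rw [Complex.exp_eq_exp_ℂ]
    exact NormedSpace.expSeries_div_hasSum_exp _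

lemma map_eq_of_moments {E : Type*} [NormedAddCommGroup E] [NormedSpace ℝ E] [CompleteSpace E]
    [SecondCountableTopology E] [MeasurableSpace E] [BorelSpace E]
    (P Q : Measure T) [IsFiniteMeasure P] [IsFiniteMeasure Q] (F : T → E) (hF : Continuous F)
    (h : ∀ (L : StrongDual ℝ E) (m : ℕ), J P Q (fun p => L (F p) ^ m) = 0) :
    P.map F = Q.map F := by
  apply Measure.ext_of_charFunDual
  ext L
  rw [charFunDual_apply, charFunDual_apply,
    integral_map hF.measurable.aemeasurable (by fun_prop),
    integral_map hF.measurable.aemeasurable (by fun_prop)]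
  have h1 := hasSum_cexp P (f := fun p => L (F p)) (by fun_prop)
  have h2 := hasSum_cexp Q (f := fun p => L (F p)) (by fun_prop)
  refine h1.unique ?_
  convert h2 using 4 with n
  exact sub_eq_zero.1 (h L n)

lemma trig_avg (a b : ℝ) (m : ℕ) :
    ∫ t in (0:ℝ)..(2 * π), (cos t * a + sin t * b) ^ m
      = (∫ t in (0:ℝ)..(2 * π), cos t ^ m) * √(a ^ 2 + b ^ 2) ^ m := by
  set z : ℂ := ⟨a, b⟩ with hz
  have hn : ‖z‖ = √(a ^ 2 + b ^ 2) := by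
    rw [Complex.norm_def, Complex.normSq_apply]; congr 1; simp [hz]; ring
  have ha : a = ‖z‖ * cos z.arg := (Complex.norm_mul_cos_arg z).symm
  have hb : b = ‖z‖ * sin z.arg := (Complex.norm_mul_sin_arg z).symm
  rw [← hn]
  have : ∀ t, (cos t * a + sin t * b) ^ m = cos (t - z.arg) ^ m * ‖z‖ ^ m := by
    intro t
    rw [cos_sub, ← mul_pow]
    congr 1
    conv_lhs => rw [ha, hb]
    ring
  simp_rw [this]
  rw [intervalIntegral.integral_mul_const]
  congr 1
  rw [intervalIntegral.integral_comp_sub_right (fun t => cos t ^ m)]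
  have hp : Function.Periodic (fun t => cos t ^ m) (2 * π) := fun t => by simp
  have := hp.intervalIntegral_add_eq (0 - z.arg) 0
  rw [zero_add] at this
  rw [← this]
  congr 1
  ring

lemma cos_odd (m : ℕ) (hm : Odd m) : ∫ t in (0:ℝ)..(2 * π), cos t ^ m = 0 := by
  have hp : Function.Periodic (fun t => cos t ^ m) (2 * π) := fun t => by simp
  have h1 := hp.intervalIntegral_add_eq π 0
  have h2 := intervalIntegral.integral_comp_add_right (a := 0) (b := 2 * π)
    (fun t => cos t ^ m) π
  simp only [cos_add_pi, hm.neg_pow, intervalIntegral.integral_neg] at h2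
  rw [zero_add] at h1 h2
  rw [show 2 * π + π = π + 2 * π by ring, h1] at h2
  linarith

lemma cos_even (k : ℕ) : ∫ t in (0:ℝ)..(2 * π), cos t ^ (2 * k) ≠ 0 := by
  apply ne_of_gt
  refine intervalIntegral.integral_pos (by positivity) (by fun_prop) ?_ ⟨0, ?_, ?_⟩
  · intro t _
    rw [pow_mul]; positivity
  · exact ⟨le_rfl, by positivity⟩
  · simp

lemma avg_one (P : Measure T) [IsFiniteMeasure P] (A B : T → ℝ) (hA : Continuous A)
    (hB : Continuous B) (m : ℕ) :
    ∫ t in (0:ℝ)..(2 * π), ∫ p, (cos t * A p + sin t * B p) ^ m ∂P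
      = (∫ t in (0:ℝ)..(2 * π), cos t ^ m) * ∫ p, √(A p ^ 2 + B p ^ 2) ^ m ∂P := by
  rw [← integral_const_mul]
  simp_rw [← trig_avg]
  rw [intervalIntegral_integral_swap]
  obtain ⟨C, hC⟩ := isCompact_univ.exists_bound_of_continuousOn (f := A) hA.continuousOn
  obtain ⟨D, hD⟩ := isCompact_univ.exists_bound_of_continuousOn (f := B) hB.continuousOn
  have hm : Measurable (fun z : ℝ × T => (cos z.1 * A z.2 + sin z.1 * B z.2) ^ m) := by
    have := hA.measurable
    have := hB.measurable
    fun_prop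
  have : IsFiniteMeasure (volume.restrict (Set.uIoc 0 (2 * π))) := by
    rw [Set.uIoc]; infer_instance
  refine Integrable.of_bound hm.aestronglyMeasurable ((C + D) ^ m)
    (Filter.Eventually.of_forall fun z => ?_)
  have h1 := hC z.2 (Set.mem_univ _)
  have h2 := hD z.2 (Set.mem_univ _)
  simp only [Function.uncurry, norm_pow]
  gcongr
  refine (norm_add_le _ _).trans ?_
  rw [norm_mul, norm_mul]
  refine add_le_add (le_trans ?_ h1) (le_trans ?_ h2)
  · exact mul_le_of_le_one_left (norm_nonneg _) (abs_cos_le_one _)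
  · exact mul_le_of_le_one_left (norm_nonneg _) (abs_sin_le_one _)

lemma flow_avg (P Q : Measure T) [IsFiniteMeasure P] [IsFiniteMeasure Q] (G : ℝ → T → T)
    (hG : ∀ t (f : T → ℝ), Continuous f → J P Q (fun p => f (G t p)) = J P Q f)
    (A B : T → ℝ) (hA : Continuous A) (hB : Continuous B)
    (hAG : ∀ t p, A (G t p) = cos t * A p + sin t * B p) (m : ℕ) :
    2 * π * J P Q (fun p => A p ^ m)
      = (∫ t in (0:ℝ)..(2 * π), cos t ^ m) * J P Q (fun p => √(A p ^ 2 + B p ^ 2) ^ m) := by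
  have cont : ∀ (ρ : Measure T) [IsFiniteMeasure ρ],
      IntervalIntegrable (fun t => ∫ p, (cos t * A p + sin t * B p) ^ m ∂ρ) volume 0 (2 * π) := by
    intro ρ _
    obtain ⟨C, hC⟩ := isCompact_univ.exists_bound_of_continuousOn (f := A) hA.continuousOn
    obtain ⟨D, hD⟩ := isCompact_univ.exists_bound_of_continuousOn (f := B) hB.continuousOn
    apply Continuous.intervalIntegrable
    refine continuous_of_dominated (bound := fun _ => (C + D) ^ m) ?_ ?_ (integrable_const _) ?_
    · intro t; exact (integrable_cont ρ (by fun_prop)).aestronglyMeasurable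
    · intro t
      refine Filter.Eventually.of_forall fun p => ?_
      have h1 := hC p (Set.mem_univ _)
      have h2 := hD p (Set.mem_univ _)
      simp only [norm_pow]
      gcongr
      refine (norm_add_le _ _).trans ?_
      rw [norm_mul, norm_mul]
      refine add_le_add (le_trans ?_ h1) (le_trans ?_ h2)
      · exact mul_le_of_le_one_left (norm_nonneg _) (abs_cos_le_one _)
      · exact mul_le_of_le_one_left (norm_nonneg _) (abs_sin_le_one _)
    · exact Filter.Eventually.of_forall fun p => by fun_prop
  have h1 := avg_one P A B hA hB m
  have h2 := avg_one Q A B hA hB m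
  have h3 : ∫ t in (0:ℝ)..(2 * π), J P Q (fun p => A p ^ m) = 2 * π * J P Q (fun p => A p ^ m) := by
    simp
  rw [← h3]
  have h4 : ∀ t, J P Q (fun p => A p ^ m)
      = (∫ p, (cos t * A p + sin t * B p) ^ m ∂P) - ∫ p, (cos t * A p + sin t * B p) ^ m ∂Q := by
    intro t
    rw [← hG t (fun p => A p ^ m) (by fun_prop)]
    simp only [J, hAG]
  rw [intervalIntegral.integral_congr (fun t _ => h4 t),
    intervalIntegral.integral_sub (cont P) (cont Q), h1, h2, J]
  ring

lemma flow_odd (P Q : Measure T) [IsFiniteMeasure P] [IsFiniteMeasure Q] (G : ℝ → T → T)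
    (hG : ∀ t (f : T → ℝ), Continuous f → J P Q (fun p => f (G t p)) = J P Q f)
    (A B : T → ℝ) (hA : Continuous A) (hB : Continuous B)
    (hAG : ∀ t p, A (G t p) = cos t * A p + sin t * B p) (m : ℕ) (hm : Odd m) :
    J P Q (fun p => A p ^ m) = 0 := by
  have := flow_avg P Q G hG A B hA hB hAG m
  rw [cos_odd m hm, zero_mul] at this
  exact (mul_eq_zero.1 this).resolve_left (by positivity)

lemma flow_even (P Q : Measure T) [IsFiniteMeasure P] [IsFiniteMeasure Q] (G : ℝ → T → T)
    (hG : ∀ t (f : T → ℝ), Continuous f → J P Q (fun p => f (G t p)) = J P Q f)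
    (A B : T → ℝ) (hA : Continuous A) (hB : Continuous B)
    (hAG : ∀ t p, A (G t p) = cos t * A p + sin t * B p) (k : ℕ) :
    J P Q (fun p => A p ^ (2 * k)) = 0 ↔ J P Q (fun p => (A p ^ 2 + B p ^ 2) ^ k) = 0 := by
  have := flow_avg P Q G hG A B hA hB hAG (2 * k)
  have hs : ∀ p, √(A p ^ 2 + B p ^ 2) ^ (2 * k) = (A p ^ 2 + B p ^ 2) ^ k := by
    intro p
    rw [pow_mul, Real.sq_sqrt (by positivity)]
  simp only [hs] at this
  constructor
  · intro h
    rw [h, mul_zero] at this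
    exact (mul_eq_zero.1 this.symm).resolve_left (cos_even k)
  · intro h
    rw [h, mul_zero] at this
    exact (mul_eq_zero.1 this).resolve_left (by positivity)

lemma J_of_map {X : Type*} [TopologicalSpace X] [MeasurableSpace X] [BorelSpace X]
    (P Q : Measure T) [IsFiniteMeasure P] [IsFiniteMeasure Q] (g h : T → X) (hg : Continuous g)
    (hh : Continuous h)
    (H : ∀ s, MeasurableSet s → P.real (g ⁻¹' s) - Q.real (g ⁻¹' s)
      = P.real (h ⁻¹' s) - Q.real (h ⁻¹' s)) (f : X → ℝ) (hf : Continuous f) :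
    J P Q (fun p => f (g p)) = J P Q (fun p => f (h p)) := by
  have e : P.map g + Q.map h = P.map h + Q.map g := by
    ext s hs
    rw [Measure.add_apply, Measure.add_apply, Measure.map_apply hg.measurable hs,
      Measure.map_apply hh.measurable hs, Measure.map_apply hg.measurable hs,
      Measure.map_apply hh.measurable hs, ← ENNReal.toReal_eq_toReal_iff' (by finiteness)
      (by finiteness), ENNReal.toReal_add (by finiteness) (by finiteness),
      ENNReal.toReal_add (by finiteness) (by finiteness)]
    have := H s hs
    simp only [Measure.real] at this
    linarith
  have I : ∀ (ρ : Measure T) [IsFiniteMeasure ρ] (k : T → X), Continuous k →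
      Integrable f (ρ.map k) := by
    intro ρ _ k hk
    rw [integrable_map_measure hf.measurable.aestronglyMeasurable hk.measurable.aemeasurable]
    exact integrable_cont ρ (hf.comp hk)
  have M : ∀ (ρ : Measure T) (k : T → X), Continuous k →
      ∫ p, f (k p) ∂ρ = ∫ x, f x ∂(ρ.map k) := fun ρ k hk =>
    (integral_map hk.measurable.aemeasurable hf.measurable.aestronglyMeasurable).symm
  have e2 := congrArg (fun ρ => ∫ x, f x ∂ρ) e
  rw [integral_add_measure (I P g hg) (I Q h hh), integral_add_measure (I P h hh) (I Q g hg)] at e2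
  unfold J
  rw [M P g hg, M Q g hg, M P h hh, M Q h hh]
  linarith

lemma J_of_signed {X : Type*} [TopologicalSpace X] [MeasurableSpace X] [BorelSpace X]
    (μ : SignedMeasure T) (g h : T → X) (hg : Continuous g) (hh : Continuous h)
    (H : μ.map g = μ.map h) (f : X → ℝ) (hf : Continuous f) :
    J μ.toJordanDecomposition.posPart μ.toJordanDecomposition.negPart (fun p => f (g p))
      = J μ.toJordanDecomposition.posPart μ.toJordanDecomposition.negPart (fun p => f (h p)) := by
  refine J_of_map _ _ g h hg hh (fun s hs => ?_) f hf
  rw [← μ.apply_eq_posPart_real_sub_negPart_real (hg.measurable hs),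
    ← μ.apply_eq_posPart_real_sub_negPart_real (hh.measurable hs),
    ← VectorMeasure.map_apply _ hg.measurable hs, H, VectorMeasure.map_apply _ hh.measurable hs]

end General

instance : CompactSpace (UnitTangentSphere 2) := by
  rw [← isCompact_iff_compactSpace]
  refine Metric.isCompact_of_isClosed_isBounded ?_ ?_
  · refine IsClosed.inter (s₁ := {p : Euc 2 × Euc 2 | ‖p.1‖ = 1})
      (s₂ := {p | ‖p.2‖ = 1 ∧ ⟪p.1, p.2⟫ = 0}) (isClosed_eq (by fun_prop) (by fun_prop)) ?_
    exact IsClosed.inter (s₁ := {p : Euc 2 × Euc 2 | ‖p.2‖ = 1})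
      (s₂ := {p | ⟪p.1, p.2⟫ = 0}) (isClosed_eq (by fun_prop) (by fun_prop))
      (isClosed_eq (by fun_prop) (by fun_prop))
  · refine (Metric.isBounded_closedBall (x := (0 : Euc 2 × Euc 2)) (r := 1)).subset ?_
    rintro p ⟨h1, h2, -⟩
    simp [Prod.norm_def, h1, h2]

lemma coords (p : UnitTangentSphere 2) :
    (p.1.1 0 ^ 2 + p.1.1 1 ^ 2 + p.1.1 2 ^ 2 = 1) ∧ (p.1.2 0 ^ 2 + p.1.2 1 ^ 2 + p.1.2 2 ^ 2 = 1) ∧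
    (p.1.1 0 * p.1.2 0 + p.1.1 1 * p.1.2 1 + p.1.1 2 * p.1.2 2 = 0) := by
  obtain ⟨h1, h2, h3⟩ := p.2
  have e1 := EuclideanSpace.real_norm_sq_eq p.1.1
  have e2 := EuclideanSpace.real_norm_sq_eq p.1.2
  rw [h1, Fin.sum_univ_three] at e1
  rw [h2, Fin.sum_univ_three] at e2
  rw [PiLp.inner_apply, Fin.sum_univ_three] at h3
  simp only [RCLike.inner_apply, conj_trivial] at h3
  exact ⟨by linarith, by linarith, by linarith⟩

/-- the cross product -/
def W (p : UnitTangentSphere 2) : Euc 2 :=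
  !₂[p.1.1 1 * p.1.2 2 - p.1.1 2 * p.1.2 1, p.1.1 2 * p.1.2 0 - p.1.1 0 * p.1.2 2,
    p.1.1 0 * p.1.2 1 - p.1.1 1 * p.1.2 0]

lemma W0 (p : UnitTangentSphere 2) : W p 0 = p.1.1 1 * p.1.2 2 - p.1.1 2 * p.1.2 1 := rfl
lemma W1 (p : UnitTangentSphere 2) : W p 1 = p.1.1 2 * p.1.2 0 - p.1.1 0 * p.1.2 2 := rfl
lemma W2 (p : UnitTangentSphere 2) : W p 2 = p.1.1 0 * p.1.2 1 - p.1.1 1 * p.1.2 0 := rfl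

@[fun_prop]
lemma continuous_W : Continuous W := by
  refine (PiLp.continuous_toLp 2 _).comp (continuous_pi fun i => ?_)
  fin_cases i <;> simp <;> fun_prop

lemma continuous_flow (t : ℝ) : Continuous (geodesicFlow 2 t) := by
  unfold geodesicFlow
  fun_prop

lemma continuous_flip : Continuous (flipMap 2) := by
  unfold flipMap
  fun_prop

lemma continuous_proj : Continuous (sphereProj 2) := by
  unfold sphereProj
  fun_prop

lemma gram (a x v : Fin 3 → ℝ) (h1 : x 0 ^ 2 + x 1 ^ 2 + x 2 ^ 2 = 1)
    (h2 : v 0 ^ 2 + v 1 ^ 2 + v 2 ^ 2 = 1) (h3 : x 0 * v 0 + x 1 * v 1 + x 2 * v 2 = 0) :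
    (a 0 * x 0 + a 1 * x 1 + a 2 * x 2) ^ 2 + (a 0 * v 0 + a 1 * v 1 + a 2 * v 2) ^ 2
      = (a 0 ^ 2 + a 1 ^ 2 + a 2 ^ 2) - (a 0 * (x 1 * v 2 - x 2 * v 1)
        + a 1 * (x 2 * v 0 - x 0 * v 2) + a 2 * (x 0 * v 1 - x 1 * v 0)) ^ 2 := by
  have key : (a 0 * (x 1 * v 2 - x 2 * v 1)
        + a 1 * (x 2 * v 0 - x 0 * v 2) + a 2 * (x 0 * v 1 - x 1 * v 0)) ^ 2
      = (a 0 ^ 2 + a 1 ^ 2 + a 2 ^ 2) * ((x 0 ^ 2 + x 1 ^ 2 + x 2 ^ 2) *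
          (v 0 ^ 2 + v 1 ^ 2 + v 2 ^ 2) - (x 0 * v 0 + x 1 * v 1 + x 2 * v 2) ^ 2)
        - (a 0 * x 0 + a 1 * x 1 + a 2 * x 2) ^ 2 * (v 0 ^ 2 + v 1 ^ 2 + v 2 ^ 2)
        - (a 0 * v 0 + a 1 * v 1 + a 2 * v 2) ^ 2 * (x 0 ^ 2 + x 1 ^ 2 + x 2 ^ 2)
        + 2 * (a 0 * x 0 + a 1 * x 1 + a 2 * x 2) * (a 0 * v 0 + a 1 * v 1 + a 2 * v 2)
          * (x 0 * v 0 + x 1 * v 1 + x 2 * v 2) := by ring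
  rw [h1, h2, h3] at key
  rw [key]; ring

lemma dual_coords (L : StrongDual ℝ (Euc 2)) :
    ∃ a : Fin 3 → ℝ, ∀ y : Euc 2, L y = a 0 * y 0 + a 1 * y 1 + a 2 * y 2 := by
  refine ⟨fun i => L (EuclideanSpace.single i 1), fun y => ?_⟩
  have : y = y 0 • EuclideanSpace.single 0 1 + y 1 • EuclideanSpace.single 1 1
      + y 2 • EuclideanSpace.single 2 1 := by
    ext i; fin_cases i <;> simp
  conv_lhs => rw [this]
  simp only [map_add, map_smul, smul_eq_mul]
  ring

section Main

lemma W_map (P Q : Measure (UnitTangentSphere 2)) [IsFiniteMeasure P] [IsFiniteMeasure Q]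
    (hG : ∀ t (f : UnitTangentSphere 2 → ℝ), Continuous f →
      J P Q (fun p => f (geodesicFlow 2 t p)) = J P Q f)
    (hS : ∀ f : UnitTangentSphere 2 → ℝ, Continuous f →
      J P Q (fun p => f (flipMap 2 p)) = J P Q f)
    (hP : ∀ f : Metric.sphere (0 : Euc 2) 1 → ℝ, Continuous f →
      J P Q (fun p => f (sphereProj 2 p)) = 0) : P.map W = Q.map W := by
  refine map_eq_of_moments P Q W continuous_W fun L m => ?_
  obtain ⟨a, ha⟩ := dual_coords L
  have hcont : Continuous fun p => L (W p) := L.continuous.comp continuous_W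
  rcases Nat.even_or_odd' m with ⟨k, rfl | rfl⟩
  · have hD : ∀ j, J P Q (fun p => ((a 0 ^ 2 + a 1 ^ 2 + a 2 ^ 2) - L (W p) ^ 2) ^ j) = 0 := by
      intro j
      have := (flow_even P Q (geodesicFlow 2) hG
        (fun p => a 0 * p.1.1 0 + a 1 * p.1.1 1 + a 2 * p.1.1 2)
        (fun p => a 0 * p.1.2 0 + a 1 * p.1.2 1 + a 2 * p.1.2 2) (by fun_prop) (by fun_prop)
        (by intro t p; simp [geodesicFlow]; ring) j).1
        (hP (fun x => (a 0 * x.1 0 + a 1 * x.1 1 + a 2 * x.1 2) ^ (2 * j)) (by fun_prop))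
      rw [← this]
      congr 1
      ext p
      obtain ⟨h1, h2, h3⟩ := coords p
      rw [gram a p.1.1 p.1.2 h1 h2 h3, ha, W0, W1, W2]
    set N := a 0 ^ 2 + a 1 ^ 2 + a 2 ^ 2 with hN
    have e : (fun p => L (W p) ^ (2 * k)) = fun p => ∑ j ∈ Finset.range (k + 1),
        ((-1) ^ j * N ^ (k - j) * (k.choose j : ℝ)) * (N - L (W p) ^ 2) ^ j := by
      ext p
      rw [pow_mul, show L (W p) ^ 2 = -(N - L (W p) ^ 2) + N by ring, add_pow]
      refine Finset.sum_congr rfl fun j _ => ?_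
      rw [neg_pow]; ring
    rw [e, J_sum P Q _ _ _ (fun i => by fun_prop)]
    exact Finset.sum_eq_zero fun j _ => by rw [hD j, mul_zero]
  · have h := hS (fun p => L (W p) ^ (2 * k + 1)) (by fun_prop)
    have e : ∀ p, L (W (flipMap 2 p)) ^ (2 * k + 1) = - L (W p) ^ (2 * k + 1) := by
      intro p
      rw [← Odd.neg_pow ⟨k, rfl⟩]
      congr 1
      rw [ha, ha]
      simp only [W0, W1, W2, flipMap, PiLp.neg_apply]
      ring
    simp only [e] at h
    simp only [J, integral_neg] at h ⊢
    linarith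

lemma meas_eq (P Q : Measure (UnitTangentSphere 2)) [IsFiniteMeasure P] [IsFiniteMeasure Q]
    (hG : ∀ t (f : UnitTangentSphere 2 → ℝ), Continuous f →
      J P Q (fun p => f (geodesicFlow 2 t p)) = J P Q f)
    (hS : ∀ f : UnitTangentSphere 2 → ℝ, Continuous f →
      J P Q (fun p => f (flipMap 2 p)) = J P Q f)
    (hP : ∀ f : Metric.sphere (0 : Euc 2) 1 → ℝ, Continuous f →
      J P Q (fun p => f (sphereProj 2 p)) = 0) : P = Q := by
  have hW := W_map P Q hG hS hP
  have hJW : ∀ f : Euc 2 → ℝ, Continuous f → J P Q (fun p => f (W p)) = 0 := by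
    intro f hf
    unfold J
    rw [← integral_map (φ := W) (f := f) continuous_W.measurable.aemeasurable
      hf.measurable.aestronglyMeasurable, ← integral_map (φ := W) (f := f)
      continuous_W.measurable.aemeasurable hf.measurable.aestronglyMeasurable, hW, sub_self]
  have hv : P.map (Subtype.val) = Q.map (Subtype.val) := by
    refine map_eq_of_moments P Q _ continuous_subtype_val fun L m => ?_
    obtain ⟨a, ha⟩ := dual_coords (L.comp (ContinuousLinearMap.inl ℝ (Euc 2) (Euc 2)))
    obtain ⟨b, hb⟩ := dual_coords (L.comp (ContinuousLinearMap.inr ℝ (Euc 2) (Euc 2)))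
    have hL : ∀ p : UnitTangentSphere 2, L p.1 = a 0 * p.1.1 0 + a 1 * p.1.1 1 + a 2 * p.1.1 2
        + (b 0 * p.1.2 0 + b 1 * p.1.2 1 + b 2 * p.1.2 2) := by
      intro p
      rw [← ha, ← hb, ContinuousLinearMap.comp_apply, ContinuousLinearMap.comp_apply, ← map_add]
      simp
    have hA : Continuous fun p : UnitTangentSphere 2 => L p.1 := by fun_prop
    have hAG : ∀ t (p : UnitTangentSphere 2), L (geodesicFlow 2 t p).1 = cos t * L p.1 + sin t *
        ((a 0 * p.1.2 0 + a 1 * p.1.2 1 + a 2 * p.1.2 2)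
        - (b 0 * p.1.1 0 + b 1 * p.1.1 1 + b 2 * p.1.1 2)) := by
      intro t p
      rw [hL, hL]
      simp [geodesicFlow]
      ring
    rcases Nat.even_or_odd' m with ⟨k, rfl | rfl⟩
    · refine (flow_even P Q (geodesicFlow 2) hG (fun p => L p.1) _ hA (by fun_prop) hAG k).2 ?_
      rw [← hJW (fun w => (((a 0 ^ 2 + a 1 ^ 2 + a 2 ^ 2) - (a 0 * w 0 + a 1 * w 1 + a 2 * w 2) ^ 2)
        + ((b 0 ^ 2 + b 1 ^ 2 + b 2 ^ 2) - (b 0 * w 0 + b 1 * w 1 + b 2 * w 2) ^ 2)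
        + 2 * ((a 1 * b 2 - a 2 * b 1) * w 0 + (a 2 * b 0 - a 0 * b 2) * w 1
          + (a 0 * b 1 - a 1 * b 0) * w 2)) ^ k) (by fun_prop)]
      congr 1
      ext p
      obtain ⟨h1, h2, h3⟩ := coords p
      rw [W0, W1, W2, ← gram a p.1.1 p.1.2 h1 h2 h3, ← gram b p.1.1 p.1.2 h1 h2 h3, hL]
      ring
    · exact flow_odd P Q (geodesicFlow 2) hG (fun p => L p.1) _ hA (by fun_prop) hAG _ ⟨k, rfl⟩
  have hm : MeasurableSet (UnitTangentSphere 2) :=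
    (isCompact_iff_compactSpace.2 inferInstance : IsCompact (UnitTangentSphere 2)).measurableSet
  have he := MeasurableEmbedding.subtype_coe hm
  rw [← he.comap_map P, ← he.comap_map Q, hv]

end Main

end FlamAux

/-- **Flaminio's theorem, constant-curvature case.** A finite signed measure on
the unit tangent bundle `S(S²)` of the standard round 2-sphere of constant
curvature 1 that is invariant under the geodesic flow `G_t` for every `t` and
under the flip map `σ`, and whose pushforward under the canonical projection
`π : S(S²) → S²` is the zero measure, must itself be zero; i.e. even
`G_t`-invariant finite signed measures on `S(S²)` are determined by their
projection to `S²`. -/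
theorem even_invariant_signedMeasure_sphere_two_eq_zero_of_proj_zero
    (μ : SignedMeasure (UnitTangentSphere 2))
    (hflow : ∀ t : ℝ, μ.map (geodesicFlow 2 t) = μ)
    (hflip : μ.map (flipMap 2) = μ)
    (hproj : μ.map (sphereProj 2) = 0) :
    μ = 0 := by
  have hid : μ.map id = μ := VectorMeasure.map_id μ
  have h := FlamAux.meas_eq μ.toJordanDecomposition.posPart μ.toJordanDecomposition.negPart
    (fun t f hf => FlamAux.J_of_signed μ _ id (FlamAux.continuous_flow t) continuous_id
      ((hflow t).trans hid.symm) f hf)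
    (fun f hf => FlamAux.J_of_signed μ _ id FlamAux.continuous_flip continuous_id
      (hflip.trans hid.symm) f hf)
    (fun f hf => by
      have e : ∀ s : Set (Metric.sphere (0 : Euc 2) 1), MeasurableSet s →
          μ (sphereProj 2 ⁻¹' s) = 0 := by
        intro s hs
        rw [← VectorMeasure.map_apply _ FlamAux.continuous_proj.measurable hs, hproj]
        rfl
      have pt : Metric.sphere (0 : Euc 2) 1 := ⟨EuclideanSpace.single 0 1, by simp⟩
      have := FlamAux.J_of_map μ.toJordanDecomposition.posPart μ.toJordanDecomposition.negPart
        (sphereProj 2) (fun _ => pt) FlamAux.continuous_proj continuous_const (fun s hs => by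
          rw [← μ.apply_eq_posPart_real_sub_negPart_real (FlamAux.continuous_proj.measurable hs),
            ← μ.apply_eq_posPart_real_sub_negPart_real (measurable_const hs), e s hs]
          by_cases hp : pt ∈ s
          · have := e Set.univ MeasurableSet.univ
            simpa [hp] using this.symm
          · simp [hp]) f hf
      rw [this]
      have h1 := e Set.univ MeasurableSet.univ
      rw [Set.preimage_univ, μ.apply_eq_posPart_real_sub_negPart_real MeasurableSet.univ] at h1
      simp only [FlamAux.J, integral_const, smul_eq_mul]
      rw [← sub_mul, h1, zero_mul])
  ext s hs
  rw [μ.apply_eq_posPart_real_sub_negPart_real hs, h, sub_self]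
  rfl
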